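/- For every λ ∈ (0, 1) and every integer n ≥ 1, ‖C_n^{(λ)}‖₂² < B(1−λ, 1/2) · (2^{1−2λ}/Γ(λ)²) · n^{2λ−2}, where B denotes the beta function and Γ the gamma function. -/

import Mathlib

open Real MeasureTheory Finset

/-- Gegenbauer polynomials `C_n^{(λ)}`: `C_0 = 1`, `C_1 = 2λx`, and
`n C_n(x) = 2(n+λ-1) x C_{n-1}(x) - (n+2λ-2) C_{n-2}(x)` for `n ≥ 2`. -/
noncomputable def gegenbauer (lam : ℝ) : ℕ → ℝ → ℝ
  | 0, _ => 1
  | 1, x => 2 * lam * x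
  | n + 2, x =>
      (2 * ((n : ℝ) + 1 + lam) * x * gegenbauer lam (n + 1) x
        - ((n : ℝ) + 2 * lam) * gegenbauer lam n x) / ((n : ℝ) + 2)

/-- The beta function `B(x,y) = Γ(x)Γ(y)/Γ(x+y)`. -/
noncomputable def betaFn (x y : ℝ) : ℝ := Real.Gamma x * Real.Gamma y / Real.Gamma (x + y)

lemma geg_rec (lam : ℝ) (n : ℕ) (x : ℝ) :
    ((n : ℝ) + 2) * gegenbauer lam (n + 2) x =
      2 * ((n : ℝ) + 1 + lam) * x * gegenbauer lam (n + 1) x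
        - ((n : ℝ) + 2 * lam) * gegenbauer lam n x := by
  have h : (n : ℝ) + 2 ≠ 0 := by positivity
  rw [gegenbauer]
  field_simp

lemma geg_cont (lam : ℝ) (n : ℕ) :
    Continuous (gegenbauer lam n) ∧ Continuous (gegenbauer lam (n + 1)) := by
  induction n with
  | zero =>
    constructor
    · have : gegenbauer lam 0 = fun _ => 1 := by ext x; rw [gegenbauer]
      rw [this]; fun_prop
    · have : gegenbauer lam (0 + 1) = fun x => 2 * lam * x := by ext x; rw [gegenbauer]
      rw [this]; fun_prop
  | succ n ih =>
    refine ⟨ih.2, ?_⟩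
    have : gegenbauer lam (n + 1 + 1) = fun x => (2 * ((n : ℝ) + 1 + lam) * x * gegenbauer lam (n + 1) x
        - ((n : ℝ) + 2 * lam) * gegenbauer lam n x) / ((n : ℝ) + 2) := by
      ext x; rw [gegenbauer]
    rw [this]
    have h1 := ih.1
    have h2 := ih.2
    fun_prop

lemma geg_deriv (lam : ℝ) (x : ℝ) (hx : 1 - x ^ 2 ≠ 0) (n : ℕ) :
    HasDerivAt (gegenbauer lam n)
      ((((n : ℝ) + 2 * lam) * x * gegenbauer lam n x - ((n : ℝ) + 1) * gegenbauer lam (n + 1) x)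
        / (1 - x ^ 2)) x ∧
    HasDerivAt (gegenbauer lam (n + 1))
      ((((n : ℝ) + 2 * lam) * gegenbauer lam n x - ((n : ℝ) + 1) * x * gegenbauer lam (n + 1) x)
        / (1 - x ^ 2)) x := by
  induction n with
  | zero =>
    have e0 : gegenbauer lam 0 = fun _ => 1 := by ext x; rw [gegenbauer]
    have e1 : gegenbauer lam (0 + 1) = fun x => 2 * lam * x := by ext x; rw [gegenbauer]
    rw [e0, e1]
    constructor
    · refine (hasDerivAt_const x (1 : ℝ)).congr_deriv ?_
      rw [eq_div_iff hx]
      push_cast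
      ring
    · refine ((hasDerivAt_id x).const_mul (2 * lam)).congr_deriv ?_
      rw [eq_div_iff hx]
      push_cast
      ring
  | succ n ih =>
    obtain ⟨h1, h2⟩ := ih
    have hr := geg_rec lam n x
    have hn : (n : ℝ) + 2 ≠ 0 := by positivity
    have hz : gegenbauer lam (n + 2) x = (2 * ((n : ℝ) + 1 + lam) * x * gegenbauer lam (n + 1) x
        - ((n : ℝ) + 2 * lam) * gegenbauer lam n x) / ((n : ℝ) + 2) := by
      rw [← hr]; field_simp
    constructor
    · refine h2.congr_deriv ?_
      congr 1
      push_cast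
      linear_combination hr
    · have e : gegenbauer lam (n + 1 + 1) = fun x => (2 * ((n : ℝ) + 1 + lam) * x * gegenbauer lam (n + 1) x
          - ((n : ℝ) + 2 * lam) * gegenbauer lam n x) / ((n : ℝ) + 2) := by
        ext x; rw [gegenbauer]
      rw [e]
      have h3 := ((((hasDerivAt_id x).const_mul (2 * ((n : ℝ) + 1 + lam))).mul h2).sub
        (h1.const_mul ((n : ℝ) + 2 * lam))).div_const ((n : ℝ) + 2)
      refine h3.congr_deriv ?_
      simp only [id]
      push_cast
      field_simp
      ring

lemma geg_sonin (lam : ℝ) (h0 : 0 < lam) (h1 : lam < 1) (n : ℕ) (x : ℝ) (hx0 : 0 ≤ x) (hx1 : x < 1) :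
    (1 - x ^ 2) ^ lam * gegenbauer lam n x ^ 2 ≤
      gegenbauer lam n 0 ^ 2 + (((n : ℝ) + 1) * gegenbauer lam (n + 1) 0) ^ 2 /
        (((n : ℝ) + lam) ^ 2 + lam * (1 - lam)) := by
  set N : ℝ := (n : ℝ) + lam with hN
  let p : ℝ → ℝ := fun x => N * x * gegenbauer lam n x - ((n : ℝ) + 1) * gegenbauer lam (n + 1) x
  let q : ℝ → ℝ := fun x => N ^ 2 * (1 - x ^ 2) + lam * (1 - lam)
  let F : ℝ → ℝ := fun x => (1 - x ^ 2) ^ lam * (gegenbauer lam n x ^ 2 + p x ^ 2 / q x)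
  have hl : 0 < lam * (1 - lam) := mul_pos h0 (by linarith)
  have hs : ∀ x ∈ Set.Ico (0 : ℝ) 1, 0 < 1 - x ^ 2 := by
    intro x hx; nlinarith [hx.1, hx.2]
  have hq : ∀ x ∈ Set.Ico (0 : ℝ) 1, 0 < q x := by
    intro x hx
    have := hs x hx
    simp only [q]; positivity
  have hF : ∀ x ∈ Set.Ico (0 : ℝ) 1, HasDerivAt F
      (-(2 * x * (lam * (1 - lam)) * p x ^ 2 * (1 - x ^ 2) ^ lam / (q x ^ 2 * (1 - x ^ 2)))) x := by
    intro x hx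
    have hsx := hs x hx
    have hqx := hq x hx
    obtain ⟨dy, dz⟩ := geg_deriv lam x hsx.ne' n
    have ds : HasDerivAt (fun x : ℝ => 1 - x ^ 2) (-(2 * x)) x := by
      have := (hasDerivAt_pow 2 x).const_sub 1
      refine this.congr_deriv ?_
      simp
    have dr := ds.rpow_const (p := lam) (Or.inl hsx.ne')
    have dp : HasDerivAt p ((-q x * gegenbauer lam n x + (lam - 1) * x * p x) / (1 - x ^ 2)) x := by
      have := ((((hasDerivAt_id x).const_mul N).mul dy).sub (dz.const_mul ((n : ℝ) + 1)))
      refine this.congr_deriv ?_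
      simp only [id, p, q, hN]
      field_simp
      ring
    have dq : HasDerivAt q (N ^ 2 * (-(2 * x))) x := (ds.const_mul (N ^ 2)).add_const _
    have dF := dr.mul ((dy.pow 2).add ((dp.pow 2).div dq hqx.ne'))
    refine dF.congr_deriv ?_
    rw [rpow_sub_one hsx.ne']
    have e : (n + 1 : ℝ) * gegenbauer lam (n + 1) x = N * x * gegenbauer lam n x - p x := by
      simp only [p]; ring
    have hqd : lam * (1 - lam) = q x - N ^ 2 * (1 - x ^ 2) := by simp only [q]; ring
    have hnd : (n : ℝ) + 2 * lam = N + lam := by rw [hN]; ring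
    simp only [Pi.pow_apply, Pi.add_apply, Pi.div_apply]
    rw [e, hqd, hnd]
    generalize p x = P at *
    generalize q x = Q at *
    generalize gegenbauer lam n x = y at *
    generalize (1 - x ^ 2) ^ lam = R at *
    have := hsx.ne'
    have := hqx.ne'
    field_simp
    push_cast
    ring
  have hanti : AntitoneOn F (Set.Ico 0 1) := by
    apply antitoneOn_of_deriv_nonpos (convex_Ico 0 1)
    · intro x hx; exact (hF x hx).continuousAt.continuousWithinAt
    · intro x hx
      exact (hF x (interior_subset hx)).differentiableAt.differentiableWithinAt
    · intro x hx
      have hx := interior_subset hx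
      rw [(hF x hx).deriv]
      have h1 := hs x hx
      have h2 := hq x hx
      have h3 := hx.1
      rw [neg_nonpos]
      positivity
  have key := hanti (a := 0) (b := x) (by simp) ⟨hx0, hx1⟩ hx0
  have e0 : F 0 = gegenbauer lam n 0 ^ 2 + (((n : ℝ) + 1) * gegenbauer lam (n + 1) 0) ^ 2 /
        (N ^ 2 + lam * (1 - lam)) := by
    simp [F, p, q]
  rw [← e0]
  refine le_trans ?_ key
  have h1 := hs x ⟨hx0, hx1⟩
  have h2 := hq x ⟨hx0, hx1⟩
  simp only [F]
  gcongr
  have : 0 ≤ p x ^ 2 / q x := by positivity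
  linarith

lemma geg_zero (lam : ℝ) (h0 : 0 < lam) (k : ℕ) :
    gegenbauer lam (2 * k) 0 = (-1) ^ k * (Gamma (k + lam) / (Gamma lam * Gamma (k + 1))) ∧
    gegenbauer lam (2 * k + 1) 0 = 0 := by
  induction k with
  | zero =>
    have := (Gamma_pos_of_pos h0).ne'
    simp [gegenbauer, this]
  | succ k ih =>
    obtain ⟨a, b⟩ := ih
    have r1 := geg_rec lam (2 * k) 0
    have r2 := geg_rec lam (2 * k + 1) 0
    have e1 : 2 * (k + 1) = 2 * k + 2 := by ring
    have e2 : 2 * k + 1 + 2 = 2 * k + 2 + 1 := by ring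
    rw [e1]
    rw [e2, b] at r2
    have hG := (Gamma_pos_of_pos h0).ne'
    have hk1 : (0:ℝ) < k + 1 := by positivity
    have hkl : (0:ℝ) < k + lam := by positivity
    have hG1 := (Gamma_pos_of_pos hk1).ne'
    constructor
    · rw [a] at r1
      push_cast at r1 ⊢
      have g1 : Gamma ((k : ℝ) + 1 + lam) = (k + lam) * Gamma (k + lam) := by
        rw [← Gamma_add_one hkl.ne']; ring_nf
      rw [g1, Gamma_add_one hk1.ne']
      have h2 : (2 * (k : ℝ) + 2) ≠ 0 := by positivity
      apply mul_left_cancel₀ h2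
      rw [r1]
      field_simp
      ring
    · have h2 : (((2 * k + 1 : ℕ) : ℝ) + 2) ≠ 0 := by positivity
      apply mul_left_cancel₀ h2
      rw [r2]; ring

lemma Gamma_ratio_le (lam : ℝ) (h0 : 0 < lam) (h1 : lam < 1) (s : ℝ) (hs : 0 < s) :
    Gamma (s + lam) ≤ Gamma s * s ^ lam := by
  have h := Gamma_mul_add_mul_le_rpow_Gamma_mul_rpow_Gamma (s := s) (t := s + 1) (a := 1 - lam)
    (b := lam) hs (by linarith) (by linarith) h0 (by ring)
  have e : (1 - lam) * s + lam * (s + 1) = s + lam := by ring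
  have hG := Gamma_pos_of_pos hs
  rw [e, Gamma_add_one hs.ne', mul_rpow hs.le hG.le] at h
  refine h.trans_eq ?_
  have : Gamma s ^ (1 - lam) * Gamma s ^ lam = Gamma s := by
    rw [← rpow_add hG]; simp
  linear_combination s ^ lam * this

lemma Gamma_ratio_lt (lam : ℝ) (h0 : 0 < lam) (h1 : lam < 1) (s : ℝ) (hs : 0 < s) :
    Gamma (s + lam) < Gamma s * s ^ lam := by
  have h := Gamma_ratio_le lam h0 h1 (s + 1) (by linarith)
  have hG := Gamma_pos_of_pos hs
  have hb := rpow_one_add_lt_one_add_mul_self (s := 1 / s) (p := lam)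
    (by have : 0 < 1 / s := by positivity
        linarith) (by positivity) h0 h1
  have e1 : Gamma (s + 1 + lam) = (s + lam) * Gamma (s + lam) := by
    rw [← Gamma_add_one (by positivity)]; ring_nf
  have e2 : (s + 1) ^ lam = s ^ lam * (1 + 1 / s) ^ lam := by
    rw [← mul_rpow hs.le (by positivity)]; congr 1; field_simp
  rw [e1, Gamma_add_one hs.ne', e2] at h
  have hp : 0 < s ^ lam := by positivity
  have h3 : s * Gamma s * (s ^ lam * (1 + 1 / s) ^ lam) < s * Gamma s * (s ^ lam * (1 + lam * (1 / s))) := by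
    gcongr
  have e4 : s * Gamma s * (s ^ lam * (1 + lam * (1 / s))) = (s + lam) * (Gamma s * s ^ lam) := by
    field_simp
  rw [e4] at h3
  exact lt_of_mul_lt_mul_left (h.trans_lt h3) (by positivity)

lemma geg_F0 (lam : ℝ) (h0 : 0 < lam) (h1 : lam < 1) (n : ℕ) (hn : 1 ≤ n) :
    gegenbauer lam n 0 ^ 2 + (((n : ℝ) + 1) * gegenbauer lam (n + 1) 0) ^ 2 /
        (((n : ℝ) + lam) ^ 2 + lam * (1 - lam)) <
      2 * ((2 : ℝ) ^ (1 - 2 * lam) / Gamma lam ^ 2) * (n : ℝ) ^ (2 * lam - 2) := by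
  have hG := Gamma_pos_of_pos h0
  have e2 : (2 : ℝ) * 2 ^ (1 - 2 * lam) = 4 / 2 ^ (2 * lam) := by
    rw [rpow_sub (by norm_num), rpow_one]; ring
  have hn0 : (0 : ℝ) < n := by exact_mod_cast hn
  have e3 : (n : ℝ) ^ (2 * lam - 2) = n ^ (2 * lam) / n ^ 2 := by
    rw [rpow_sub hn0]; norm_num
  have e4 : 2 * ((2 : ℝ) ^ (1 - 2 * lam) / Gamma lam ^ 2) * (n : ℝ) ^ (2 * lam - 2) =
      (4 / 2 ^ (2 * lam)) / Gamma lam ^ 2 * (n ^ (2 * lam) / n ^ 2) := by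
    rw [← e2, e3]; ring
  rw [e4]
  rcases Nat.even_or_odd' n with ⟨k, rfl | rfl⟩
  · obtain ⟨a, b⟩ := geg_zero lam h0 k
    have hk : (0 : ℝ) < k := by
      have : 0 < k := by omega
      exact_mod_cast this
    have hr := Gamma_ratio_lt lam h0 h1 k hk
    have hGk := Gamma_pos_of_pos hk
    have hGl := Gamma_pos_of_pos (add_pos hk h0)
    rw [a, b, Gamma_add_one hk.ne']
    push_cast
    rw [mul_rpow (by norm_num) hk.le]
    have e5 : (k : ℝ) ^ (2 * lam) = (k ^ lam) ^ 2 := by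
      rw [mul_comm, rpow_mul hk.le]; norm_num
    rw [e5, mul_pow, ← pow_mul, mul_comm k 2, pow_mul]
    have : Gamma (k + lam) ^ 2 < (Gamma k * k ^ lam) ^ 2 := by gcongr
    have h2 : (0 : ℝ) < 2 ^ (2 * lam) := by positivity
    have lhs : ((-1 : ℝ) ^ 2) ^ k * (Gamma (k + lam) / (Gamma lam * (k * Gamma k))) ^ 2 +
        ((2 * k + 1 : ℝ) * 0) ^ 2 / ((2 * k + lam) ^ 2 + lam * (1 - lam)) =
        Gamma (k + lam) ^ 2 / (Gamma lam * (k * Gamma k)) ^ 2 := by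
      simp [div_pow]
    have rhs : 4 / (2 : ℝ) ^ (2 * lam) / Gamma lam ^ 2 * (2 ^ (2 * lam) * (k ^ lam) ^ 2 / (2 * k) ^ 2)
        = (Gamma k * k ^ lam) ^ 2 / (Gamma lam * (k * Gamma k)) ^ 2 := by
      field_simp; norm_num
    rw [lhs, rhs]
    gcongr
  · obtain ⟨-, b⟩ := geg_zero lam h0 k
    obtain ⟨a, -⟩ := geg_zero lam h0 (k + 1)
    have hk : (0 : ℝ) < ((k + 1 : ℕ) : ℝ) := by positivity
    have hr := Gamma_ratio_lt lam h0 h1 _ hk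
    have hGk := Gamma_pos_of_pos hk
    have hGl := Gamma_pos_of_pos (add_pos hk h0)
    have e1 : 2 * k + 1 + 1 = 2 * (k + 1) := by ring
    rw [e1, a, b, Gamma_add_one hk.ne']
    have hc : (((2 * k + 1 : ℕ) : ℝ) + 1) = 2 * ((k + 1 : ℕ) : ℝ) := by push_cast; ring
    rw [hc]
    set m : ℝ := ((2 * k + 1 : ℕ) : ℝ) with hm
    set K : ℝ := ((k + 1 : ℕ) : ℝ) with hK
    have hl : 0 < lam * (1 - lam) := mul_pos h0 (by linarith)
    have hq : 0 < (m + lam) ^ 2 + lam * (1 - lam) := by positivity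
    have hb := rpow_one_add_le_one_add_mul_self (s := 2 / m + 1 / m ^ 2) (p := lam)
      (by have : 0 < 2 / m + 1 / m ^ 2 := by positivity
          linarith) h0.le h1.le
    have e5 : 1 + (2 / m + 1 / m ^ 2) = (2 * K / m) ^ 2 := by
      rw [← hc]; field_simp; ring
    have e6 : ((2 * K / m) ^ 2) ^ lam = 2 ^ (2 * lam) * (K ^ lam) ^ 2 / m ^ (2 * lam) := by
      rw [← rpow_natCast, ← rpow_mul (by positivity), div_rpow (by positivity) hn0.le,
        mul_rpow (by positivity) hk.le]
      push_cast
      have : K ^ (2 * lam) = (K ^ lam) ^ 2 := by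
        rw [mul_comm, rpow_mul hk.le]; norm_num
      rw [this]
    have e7 : 1 + lam * (2 / m + 1 / m ^ 2) = ((m + lam) ^ 2 + lam * (1 - lam)) / m ^ 2 := by
      field_simp; ring
    rw [e5, e6, e7] at hb
    have hs : ((-1 : ℝ) ^ (k + 1)) ^ 2 = 1 := by rw [← pow_mul, mul_comm, pow_mul]; simp
    have this : Gamma (K + lam) ^ 2 < (Gamma K * K ^ lam) ^ 2 := by gcongr
    generalize (m + lam) ^ 2 + lam * (1 - lam) = q at *
    have lhs : (0 : ℝ) ^ 2 + (2 * K * ((-1) ^ (k + 1) * (Gamma (K + lam) / (Gamma lam * (K * Gamma K))))) ^ 2 / q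
        = 4 * Gamma (K + lam) ^ 2 / (Gamma lam ^ 2 * Gamma K ^ 2 * q) := by
      simp only [mul_pow, hs, div_pow]
      field_simp; ring
    rw [lhs]
    have h2 : (0 : ℝ) < 2 ^ (2 * lam) := by positivity
    have hmm : (0 : ℝ) < m ^ (2 * lam) := by positivity
    calc 4 * Gamma (K + lam) ^ 2 / (Gamma lam ^ 2 * Gamma K ^ 2 * q)
        < 4 * (Gamma K * K ^ lam) ^ 2 / (Gamma lam ^ 2 * Gamma K ^ 2 * q) := by gcongr
      _ = 4 / 2 ^ (2 * lam) / Gamma lam ^ 2 * m ^ (2 * lam) / q *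
            (2 ^ (2 * lam) * (K ^ lam) ^ 2 / m ^ (2 * lam)) := by field_simp
      _ ≤ 4 / 2 ^ (2 * lam) / Gamma lam ^ 2 * m ^ (2 * lam) / q * (q / m ^ 2) := by gcongr
      _ = _ := by field_simp

lemma beta_int (lam : ℝ) (h1 : lam < 1) :
    IntegrableOn (fun x : ℝ => (1 - x ^ 2) ^ (-lam)) (Set.Ioo 0 1) ∧
    ∫ x in Set.Ioo (0 : ℝ) 1, (1 - x ^ 2) ^ (-lam) = betaFn (1 - lam) (1 / 2) / 2 := by
  have ha : (0 : ℝ) < 1 / 2 := by norm_num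
  have hb : 0 < 1 - lam := by linarith
  set g := ProbabilityTheory.betaPDFReal (1 / 2) (1 - lam) with hg
  set B := ProbabilityTheory.beta (1 / 2) (1 - lam) with hB
  have hBpos : 0 < B := ProbabilityTheory.beta_pos ha hb
  have hBe : betaFn (1 - lam) (1 / 2) = B := by
    rw [hB, ProbabilityTheory.beta, betaFn, mul_comm, add_comm]
  have hnn : ∀ x, 0 ≤ g x := by
    intro x
    by_cases hx : 0 < x ∧ x < 1
    · exact (ProbabilityTheory.betaPDFReal_pos hx.1 hx.2 ha hb).le
    · simp [hg, ProbabilityTheory.betaPDFReal, hx]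
  have hl : ∫⁻ x, ENNReal.ofReal (g x) = 1 := ProbabilityTheory.lintegral_betaPDF_eq_one ha hb
  have hsm : StronglyMeasurable g := ProbabilityTheory.stronglyMeasurable_betaPDFReal _ _
  have hint : Integrable g := by
    refine ⟨hsm.aestronglyMeasurable, ?_⟩
    rw [hasFiniteIntegral_iff_ofReal (Filter.Eventually.of_forall hnn), hl]
    simp
  have hval : ∫ x, g x = 1 := by
    rw [integral_eq_lintegral_of_nonneg_ae (Filter.Eventually.of_forall hnn)
      hsm.aestronglyMeasurable, hl]
    simp
  have hval0 : ∫ x in Set.Ioi (0 : ℝ), g x = 1 := by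
    rw [← hval]
    apply setIntegral_eq_integral_of_forall_compl_eq_zero
    intro x hx
    have : ¬ (0 < x ∧ x < 1) := fun h => hx h.1
    simp [hg, ProbabilityTheory.betaPDFReal, this]
  have hcv := integral_comp_rpow_Ioi g (p := 2) (by norm_num)
  have hci := (integrableOn_Ioi_comp_rpow_iff g (p := 2) (by norm_num)).2 hint.integrableOn
  have heq : ∀ x ∈ Set.Ioi (0 : ℝ), (|(2 : ℝ)| * x ^ ((2 : ℝ) - 1)) • g (x ^ (2 : ℝ)) =
      (Set.Ioo (0 : ℝ) 1).indicator (fun x => (2 / B) * (1 - x ^ 2) ^ (-lam)) x := by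
    intro x hx
    have hx : 0 < x := hx
    have e : x ^ (2 : ℝ) = x ^ 2 := by norm_num
    by_cases h : x < 1
    · have hm : x ∈ Set.Ioo (0 : ℝ) 1 := ⟨hx, h⟩
      have h2 : 0 < x ^ 2 ∧ x ^ 2 < 1 := ⟨by positivity, by nlinarith⟩
      rw [Set.indicator_of_mem hm, e, hg, ProbabilityTheory.betaPDFReal, if_pos h2]
      have e3 : (x ^ 2) ^ ((1 : ℝ) / 2 - 1) = x⁻¹ := by
        rw [← e, ← rpow_mul hx.le]; norm_num [rpow_neg_one]
      have e4 : 1 - lam - 1 = -lam := by ring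
      have e5 : x ^ ((2 : ℝ) - 1) = x := by norm_num
      rw [e3, e4, e5, smul_eq_mul, abs_of_pos (by norm_num : (0:ℝ) < 2), ← hB]
      field_simp
    · have hm : x ∉ Set.Ioo (0 : ℝ) 1 := fun h' => h h'.2
      have h2 : ¬ (0 < x ^ 2 ∧ x ^ 2 < 1) := by
        rintro ⟨-, h'⟩; push Not at h; nlinarith
      rw [Set.indicator_of_notMem hm, e, hg, ProbabilityTheory.betaPDFReal, if_neg h2, smul_zero]
  rw [setIntegral_congr_fun measurableSet_Ioi heq, setIntegral_indicator measurableSet_Ioo, hval0,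
    Set.inter_eq_right.2 Set.Ioo_subset_Ioi_self, integral_const_mul] at hcv
  rw [integrableOn_congr_fun heq measurableSet_Ioi, integrableOn_indicator_iff measurableSet_Ioo,
    Set.inter_eq_left.2 Set.Ioo_subset_Ioi_self] at hci
  constructor
  · have := hci.const_mul (B / 2)
    refine this.congr (Filter.Eventually.of_forall fun x => ?_)
    simp only
    field_simp
  · rw [hBe]
    field_simp at hcv
    linarith

theorem gegenbauer_L2_norm_upper_bound (lam : ℝ) (hlam : lam ∈ Set.Ioo (0 : ℝ) 1)
    (n : ℕ) (hn : 1 ≤ n) :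
    (∫ x in (0:ℝ)..1, (gegenbauer lam n x) ^ 2) <
      betaFn (1 - lam) (1/2) * ((2 : ℝ) ^ (1 - 2 * lam) / Real.Gamma lam ^ 2)
        * (n : ℝ) ^ (2 * lam - 2) := by
  obtain ⟨h0, h1⟩ := hlam
  obtain ⟨hi, hv⟩ := beta_int lam h1
  have hF := geg_F0 lam h0 h1 n hn
  have hS := geg_sonin lam h0 h1 n
  set M := gegenbauer lam n 0 ^ 2 + (((n : ℝ) + 1) * gegenbauer lam (n + 1) 0) ^ 2 /
        (((n : ℝ) + lam) ^ 2 + lam * (1 - lam)) with hM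
  have hB : 0 < betaFn (1 - lam) (1/2) := by
    have := Gamma_pos_of_pos (show 0 < 1 - lam by linarith)
    have := Gamma_pos_of_pos (show (0 : ℝ) < 1 / 2 by norm_num)
    have := Gamma_pos_of_pos (show 0 < 1 - lam + 1 / 2 by linarith)
    unfold betaFn
    positivity
  rw [intervalIntegral.integral_of_le zero_le_one, integral_Ioc_eq_integral_Ioo]
  have hle : ∫ x in Set.Ioo (0 : ℝ) 1, gegenbauer lam n x ^ 2 ≤
      ∫ x in Set.Ioo (0 : ℝ) 1, M * (1 - x ^ 2) ^ (-lam) := by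
    apply setIntegral_mono_on _ (hi.const_mul M) measurableSet_Ioo
    · intro x hx
      have hs : 0 < 1 - x ^ 2 := by nlinarith [hx.1, hx.2]
      have := hS x hx.1.le hx.2
      rw [rpow_neg hs.le, ← div_eq_mul_inv, le_div_iff₀ (by positivity)]
      linarith
    · exact (((geg_cont lam n).1.pow 2).integrableOn_Icc (a := 0) (b := 1)).mono_set
        Set.Ioo_subset_Icc_self
  rw [integral_const_mul, hv] at hle
  refine hle.trans_lt ?_
  calc M * (betaFn (1 - lam) (1 / 2) / 2)
      < (2 * ((2 : ℝ) ^ (1 - 2 * lam) / Gamma lam ^ 2) * (n : ℝ) ^ (2 * lam - 2)) *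
        (betaFn (1 - lam) (1 / 2) / 2) := by gcongr
    _ = _ := by ring
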